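/- arXiv:2405.11291 — 2 statements merged into one kernel-verified Lean document; each statement's English description precedes it below -/
import Mathlib

section
/- Assume ∫_{(0,∞)} z^{1+α/d} λ(dz) < ∞. Then the constant C := (α ω_d / d) ∫_{0}^{∞} u^{α/d} ( ∫_{(u/g(0), ∞)} g^{-1}(u/z)^{d} λ(dz) ) du is finite and positive, and η̄(r) ∼ C · r^{-(1+α/d)} as r → ∞. Here ω_d denotes the Lebesgue measure of the unit ball in ℝ^d. -/
open MeasureTheory Set Filter Topology
open scoped ENNReal NNReal

/-- The heat-kernel profile `p_s(y) = s^{-d/α} g(|y|/s^{1/α})`. -/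
noncomputable def pker (d : ℕ) (α : ℝ) (g : ℝ → ℝ) (s : ℝ)
    (y : EuclideanSpace ℝ (Fin d)) : ℝ :=
  s ^ (-((d : ℝ) / α)) * g (‖y‖ / s ^ ((1 : ℝ) / α))

/-- `etaBar d α t g lam r = η̄(r)`, where
`η(B) = (Leb_(0,t] ⊗ Leb_{ℝ^d} ⊗ λ)({(s,y,z) : p_s(y)·z ∈ B})` and `η̄(r) = η((r,∞))`. -/
noncomputable def etaBar (d : ℕ) (α t : ℝ) (g : ℝ → ℝ) (lam : MeasureTheory.Measure ℝ)
    (r : ℝ) : ℝ≥0∞ :=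
  ((MeasureTheory.volume.restrict (Set.Ioc (0:ℝ) t)).prod
      ((MeasureTheory.volume : MeasureTheory.Measure (EuclideanSpace ℝ (Fin d))).prod
        (lam.restrict (Set.Ioi (0:ℝ)))))
    {q : ℝ × EuclideanSpace ℝ (Fin d) × ℝ | r < pker d α g q.1 q.2.1 * q.2.2}

/-- The inverse profile, extended by zero outside `(0, g 0)`. -/
noncomputable def profileInv (g ginv : ℝ → ℝ) : ℝ → ℝ := (Ioo 0 (g 0)).indicator ginv

section Profile

variable {g ginv : ℝ → ℝ}

lemma exists_eq_of_mem_Ioc {c₀ p : ℝ} (hp : 0 < p) (hg_cont : ContinuousOn g (Ici 0))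
    (hg_tail : Tendsto (fun r : ℝ => r ^ p * g r) atTop (𝓝 c₀))
    {v : ℝ} (hv : v ∈ Ioc 0 (g 0)) : ∃ x, 0 ≤ x ∧ g x = v := by
  have h0 : Tendsto g atTop (𝓝 0) := by
    have h1 := (tendsto_rpow_neg_atTop hp).mul hg_tail
    rw [zero_mul] at h1
    refine h1.congr' ?_
    filter_upwards [eventually_gt_atTop 0] with r hr
    rw [← mul_assoc, ← Real.rpow_add hr]
    simp
  obtain ⟨b, hb, hb0⟩ := ((h0.eventually_lt_const hv.1).and (eventually_ge_atTop 0)).exists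
  have := intermediate_value_Icc' hb0 (hg_cont.mono Icc_subset_Ici_self)
  obtain ⟨x, hx, hxv⟩ := this ⟨hb.le, hv.2⟩
  exact ⟨x, hx.1, hxv⟩

lemma lt_profileInv_iff (hg_anti : StrictAntiOn g (Ici 0))
    (hsurj : ∀ v ∈ Ioc 0 (g 0), ∃ x, 0 ≤ x ∧ g x = v)
    (hginv_left : ∀ x : ℝ, 0 ≤ x → ginv (g x) = x)
    {v x : ℝ} (hv : 0 < v) (hx : 0 ≤ x) : x < profileInv g ginv v ↔ v < g x := by
  unfold profileInv
  by_cases h : v < g 0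
  · obtain ⟨w, hw, rfl⟩ := hsurj v ⟨hv, h.le⟩
    rw [indicator_of_mem (by exact ⟨hv, h⟩), hginv_left w hw]
    exact (hg_anti.lt_iff_gt hw hx).symm
  · rw [indicator_of_notMem (by simp [h])]
    have : g x ≤ g 0 := hg_anti.antitoneOn self_mem_Ici hx hx
    constructor <;> intro <;> linarith

lemma profileInv_nonneg (hsurj : ∀ v ∈ Ioc 0 (g 0), ∃ x, 0 ≤ x ∧ g x = v)
    (hginv_left : ∀ x : ℝ, 0 ≤ x → ginv (g x) = x) (v : ℝ) : 0 ≤ profileInv g ginv v := by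
  refine indicator_nonneg (fun v hv => ?_) v
  obtain ⟨w, hw, rfl⟩ := hsurj v (Ioo_subset_Ioc_self hv)
  rwa [hginv_left w hw]

lemma measurable_profileInv (hg_anti : StrictAntiOn g (Ici 0))
    (hsurj : ∀ v ∈ Ioc 0 (g 0), ∃ x, 0 ≤ x ∧ g x = v)
    (hginv_left : ∀ x : ℝ, 0 ≤ x → ginv (g x) = x) : Measurable (profileInv g ginv) := by
  refine measurable_of_Ioi fun x => ?_
  rcases lt_or_ge x 0 with hx | hx
  · convert MeasurableSet.univ
    exact eq_univ_of_forall fun v => hx.trans_le (profileInv_nonneg hsurj hginv_left v)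
  · convert measurableSet_Ioo (a := (0 : ℝ)) (b := g x)
    ext v
    rw [mem_preimage, mem_Ioi, mem_Ioo]
    rcases le_or_gt v 0 with hv | hv
    · have : profileInv g ginv v = 0 := indicator_of_notMem (fun h => hv.not_gt h.1) _
      rw [this]
      constructor
      · intro h; linarith
      · intro h; linarith [h.1]
    · rw [lt_profileInv_iff hg_anti hsurj hginv_left hv hx]
      simp [hv]

lemma exists_rpow_mul_le {c₀ p : ℝ} (hp : 0 < p) (hg_anti : StrictAntiOn g (Ici 0))
    (hg_pos : ∀ x : ℝ, 0 ≤ x → 0 < g x)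
    (hg_tail : Tendsto (fun r : ℝ => r ^ p * g r) atTop (𝓝 c₀)) :
    ∃ M, 0 ≤ M ∧ ∀ x, 0 ≤ x → x ^ p * g x ≤ M := by
  obtain ⟨R, hR⟩ := eventually_atTop.1 (hg_tail.eventually_le_const (lt_add_one c₀))
  have hR' : 0 ≤ max R 0 := le_max_right _ _
  refine ⟨max (c₀ + 1) (max R 0 ^ p * g 0), ?_, fun x hx => ?_⟩
  · exact le_max_of_le_right (mul_nonneg (Real.rpow_nonneg hR' _) (hg_pos 0 le_rfl).le)
  · rcases le_total R x with h | h
    · exact le_max_of_le_left (hR x h)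
    · refine le_max_of_le_right (mul_le_mul ?_ ?_ (hg_pos x hx).le (Real.rpow_nonneg hR' _))
      · exact Real.rpow_le_rpow hx (h.trans (le_max_left _ _)) hp.le
      · exact hg_anti.antitoneOn self_mem_Ici hx hx

lemma lintegral_profileInv_ne_top {d : ℕ} {α c₀ : ℝ} (hd : 1 ≤ d) (hα : 0 < α)
    (hg_anti : StrictAntiOn g (Ici 0)) (hg_pos : ∀ x : ℝ, 0 ≤ x → 0 < g x)
    (hg_tail : Tendsto (fun r : ℝ => r ^ ((d : ℝ) + α) * g r) atTop (𝓝 c₀))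
    (hsurj : ∀ v ∈ Ioc 0 (g 0), ∃ x, 0 ≤ x ∧ g x = v)
    (hginv_left : ∀ x : ℝ, 0 ≤ x → ginv (g x) = x) :
    ∫⁻ v in Ioi (0 : ℝ), ENNReal.ofReal (v ^ (α / (d : ℝ))) *
      ENNReal.ofReal (profileInv g ginv v ^ d) ≠ ⊤ := by
  have hd0 : (0 : ℝ) < d := by exact_mod_cast hd
  have hp : 0 < (d : ℝ) + α := by positivity
  obtain ⟨M, hM0, hM⟩ := exists_rpow_mul_le hp hg_anti hg_pos hg_tail
  set q : ℝ := d / (d + α) with hq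
  have hq1 : q < 1 := by rw [hq, div_lt_one hp]; linarith
  have he : -1 < α / d - q := by
    have : 0 < α / (d : ℝ) := by positivity
    linarith
  have hbound : ∀ v ∈ Ioi (0 : ℝ), ENNReal.ofReal (v ^ (α / (d : ℝ))) *
      ENNReal.ofReal (profileInv g ginv v ^ d) ≤
      (Ioo 0 (g 0)).indicator (fun v => ENNReal.ofReal (M ^ q * v ^ (α / d - q))) v := by
    intro v hv
    have hv : 0 < v := hv
    by_cases h : v ∈ Ioo 0 (g 0)
    · rw [indicator_of_mem h, profileInv, indicator_of_mem h,
        ← ENNReal.ofReal_mul (Real.rpow_nonneg hv.le _)]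
      refine ENNReal.ofReal_le_ofReal ?_
      obtain ⟨x, hx, hxv⟩ := hsurj v (Ioo_subset_Ioc_self h)
      have hx' : ginv v = x := by rw [← hxv, hginv_left x hx]
      rw [hx', Real.rpow_sub hv]
      have h1 : (x ^ ((d : ℝ) + α) * v) ^ q ≤ M ^ q := by
        rw [← hxv]
        refine Real.rpow_le_rpow ?_ (hM x hx) (by positivity)
        exact mul_nonneg (Real.rpow_nonneg hx _) (hg_pos x hx).le
      rw [Real.mul_rpow (Real.rpow_nonneg hx _) hv.le, ← Real.rpow_mul hx,
        show ((d : ℝ) + α) * q = d by rw [hq]; field_simp, Real.rpow_natCast] at h1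
      have h2 : 0 < v ^ q := Real.rpow_pos_of_pos hv _
      have h3 : 0 < v ^ (α / (d : ℝ)) := Real.rpow_pos_of_pos hv _
      rw [mul_div_assoc', le_div_iff₀ h2]
      calc v ^ (α / (d : ℝ)) * x ^ d * v ^ q = (x ^ d * v ^ q) * v ^ (α / (d : ℝ)) := by ring
        _ ≤ _ := by gcongr
    · rw [indicator_of_notMem h, profileInv, indicator_of_notMem h]
      simp [zero_pow (by omega : d ≠ 0)]
  refine ((setLIntegral_mono' measurableSet_Ioi hbound).trans_lt ?_).ne
  refine (setLIntegral_le_lintegral _ _).trans_lt ?_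
  rw [lintegral_indicator measurableSet_Ioo]
  have hint : IntegrableOn (fun v : ℝ => M ^ q * v ^ (α / d - q)) (Ioo 0 (g 0)) :=
    ((intervalIntegral.integrableOn_Ioo_rpow_iff (hg_pos 0 le_rfl)).2 he).const_mul _
  exact hint.lintegral_lt_top

lemma lintegral_profileInv_pos {d : ℕ} {α : ℝ} (hg_anti : StrictAntiOn g (Ici 0))
    (hg_pos : ∀ x : ℝ, 0 ≤ x → 0 < g x)
    (hsurj : ∀ v ∈ Ioc 0 (g 0), ∃ x, 0 ≤ x ∧ g x = v)
    (hginv_left : ∀ x : ℝ, 0 ≤ x → ginv (g x) = x) :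
    0 < ∫⁻ v in Ioi (0 : ℝ), ENNReal.ofReal (v ^ (α / (d : ℝ))) *
      ENNReal.ofReal (profileInv g ginv v ^ d) := by
  have hm := measurable_profileInv hg_anti hsurj hginv_left
  rw [setLIntegral_pos_iff (by fun_prop)]
  refine lt_of_lt_of_le ?_ (measure_mono (s := Ioo 0 (g 0)) fun v hv => ⟨?_, hv.1⟩)
  · simpa using hg_pos 0 le_rfl
  · have h1 := Real.rpow_pos_of_pos hv.1 (α / (d : ℝ))
    have h2 := pow_pos ((lt_profileInv_iff hg_anti hsurj hginv_left hv.1 le_rfl).2 hv.2) d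
    simp [h1, h2]

end Profile

lemma lintegral_Ioi_rpow_mul_comp_div (a : ℝ) (F : ℝ → ℝ≥0∞) {z : ℝ} (hz : 0 < z) :
    ∫⁻ u in Ioi (0 : ℝ), ENNReal.ofReal (u ^ a) * F (u / z) =
      ENNReal.ofReal (z ^ (1 + a)) * ∫⁻ v in Ioi (0 : ℝ), ENNReal.ofReal (v ^ a) * F v := by
  have himg : (fun v => z * v) '' Ioi (0 : ℝ) = Ioi 0 := by
    rw [image_mul_left_Ioi hz, mul_zero]
  have h := lintegral_image_eq_lintegral_abs_deriv_mul (s := Ioi (0 : ℝ)) (f := fun v => z * v)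
    (f' := fun _ => z) measurableSet_Ioi
    (fun v _ => by simpa using ((hasDerivAt_id v).const_mul z).hasDerivWithinAt)
    (mul_right_injective₀ hz.ne').injOn (fun u => ENNReal.ofReal (u ^ a) * F (u / z))
  rw [himg] at h
  rw [h, ← lintegral_const_mul' _ _ ENNReal.ofReal_ne_top]
  refine setLIntegral_congr_fun measurableSet_Ioi fun v hv => ?_
  have hv : 0 < v := hv
  rw [mul_div_cancel_left₀ _ hz.ne', abs_of_pos hz, Real.mul_rpow hz.le hv.le, ← mul_assoc,
    ← mul_assoc, ← ENNReal.ofReal_mul hz.le, ← ENNReal.ofReal_mul (Real.rpow_nonneg hz.le _),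
    Real.rpow_add hz, Real.rpow_one, mul_assoc]

lemma lintegral_Ioc_rpow_mul_comp {b t r : ℝ} (hb : 0 < b) (ht : 0 < t) (hr : 0 < r)
    (F : ℝ → ℝ≥0∞) :
    ∫⁻ u in Ioc 0 (r * t ^ b), ENNReal.ofReal (u ^ b⁻¹) * F u =
      ENNReal.ofReal (b * r ^ (1 + b⁻¹)) *
        ∫⁻ s in Ioc 0 t, ENNReal.ofReal (s ^ b) * F (r * s ^ b) := by
  have himg : (fun s : ℝ => r * s ^ b) '' Ioc 0 t = Ioc 0 (r * t ^ b) := by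
    ext u
    constructor
    · rintro ⟨s, hs, rfl⟩
      have := hs.1
      exact ⟨by positivity,
        mul_le_mul_of_nonneg_left (Real.rpow_le_rpow hs.1.le hs.2 hb.le) hr.le⟩
    · rintro ⟨hu, hut⟩
      have hur : 0 < u / r := by positivity
      refine ⟨(u / r) ^ b⁻¹, ⟨by positivity, ?_⟩, ?_⟩
      · rw [Real.rpow_inv_le_iff_of_pos hur.le ht.le hb, div_le_iff₀ hr]
        linarith
      · simp only
        rw [Real.rpow_inv_rpow hur.le hb.ne']
        field_simp
  have h := lintegral_image_eq_lintegral_abs_deriv_mul (s := Ioc 0 t)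
    (f := fun s : ℝ => r * s ^ b) (f' := fun s => r * (b * s ^ (b - 1))) measurableSet_Ioc
    (fun s hs => ((Real.hasDerivAt_rpow_const (Or.inl hs.1.ne')).const_mul r).hasDerivWithinAt)
    (fun x hx y hy hxy =>
      (Real.rpow_left_inj hx.1.le hy.1.le hb.ne').1 (mul_right_injective₀ hr.ne' hxy))
    (fun u => ENNReal.ofReal (u ^ b⁻¹) * F u)
  rw [himg] at h
  rw [h, ← lintegral_const_mul' _ _ ENNReal.ofReal_ne_top]
  refine setLIntegral_congr_fun measurableSet_Ioc fun s hs => ?_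
  have hs0 : 0 < s := hs.1
  rw [← mul_assoc, ← ENNReal.ofReal_mul (abs_nonneg _),
    ← mul_assoc (ENNReal.ofReal (b * r ^ (1 + b⁻¹))), ← ENNReal.ofReal_mul (by positivity),
    abs_of_pos (by positivity),
    Real.mul_rpow hr.le (by positivity), Real.rpow_rpow_inv hs0.le hb.ne', Real.rpow_add hr,
    Real.rpow_one, Real.rpow_sub_one hs0.ne']
  congr 2
  field_simp

lemma volume_pker_slice {d : ℕ} {α s r z : ℝ} {g G : ℝ → ℝ} (hd : 1 ≤ d)
    (hs : 0 < s) (hr : 0 < r) (hz : 0 < z) (hG0 : ∀ v, 0 ≤ G v)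
    (hG : ∀ v x, 0 < v → 0 ≤ x → (x < G v ↔ v < g x)) :
    volume {y : EuclideanSpace ℝ (Fin d) | r < pker d α g s y * z} =
      ENNReal.ofReal (s ^ ((d : ℝ) / α)) * ENNReal.ofReal (G (r * s ^ ((d : ℝ) / α) / z) ^ d) *
        volume (Metric.ball (0 : EuclideanSpace ℝ (Fin d)) 1) := by
  have hsα : 0 < s ^ ((1 : ℝ) / α) := by positivity
  have hset : {y : EuclideanSpace ℝ (Fin d) | r < pker d α g s y * z} =
      Metric.ball 0 (s ^ ((1 : ℝ) / α) * G (r * s ^ ((d : ℝ) / α) / z)) := by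
    ext y
    have hb : 0 < s ^ ((d : ℝ) / α) := by positivity
    rw [mem_ofPred_eq, mem_ball_zero_iff, ← div_lt_iff₀' hsα,
      hG _ _ (by positivity) (by positivity), pker, Real.rpow_neg hs.le, div_lt_iff₀ hz,
      inv_mul_eq_div, div_mul_eq_mul_div, lt_div_iff₀ hb]
  have : Nonempty (Fin d) := ⟨⟨0, hd⟩⟩
  rw [hset, Measure.addHaar_ball _ _ (mul_nonneg hsα.le (hG0 _)), finrank_euclideanSpace_fin,
    mul_pow, ENNReal.ofReal_mul (by positivity), ← Real.rpow_natCast, ← Real.rpow_mul hs.le,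
    one_div_mul_eq_div]

lemma etaBar_eq_lintegral {d : ℕ} {α t r : ℝ} {g G : ℝ → ℝ} (lam : Measure ℝ) [SigmaFinite lam]
    (hd : 1 ≤ d) (hr : 0 < r) (hg_cont : ContinuousOn g (Ici 0)) (hG0 : ∀ v, 0 ≤ G v)
    (hG : ∀ v x, 0 < v → 0 ≤ x → (x < G v ↔ v < g x)) :
    etaBar d α t g lam r = volume (Metric.ball (0 : EuclideanSpace ℝ (Fin d)) 1) *
      ∫⁻ s in Ioc 0 t, ENNReal.ofReal (s ^ ((d : ℝ) / α)) *
        ∫⁻ z in Ioi (0 : ℝ), ENNReal.ofReal (G (r * s ^ ((d : ℝ) / α) / z) ^ d) ∂lam := by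
  set g' : ℝ → ℝ := fun x => g (max x 0) with hg'
  have hg'c : Continuous g' :=
    hg_cont.comp_continuous (by fun_prop) fun x => le_max_right x 0
  have hg'm := hg'c.measurable
  have hG' : ∀ v x, 0 < v → 0 ≤ x → (x < G v ↔ v < g' x) := fun v x hv hx => by
    simp only [hG v x hv hx, hg', max_eq_left hx]
  have hmeas : MeasurableSet {q : ℝ × EuclideanSpace ℝ (Fin d) × ℝ |
      r < pker d α g' q.1 q.2.1 * q.2.2} := by
    refine measurableSet_lt measurable_const ?_
    unfold pker
    fun_prop
  have hae : ({q : ℝ × EuclideanSpace ℝ (Fin d) × ℝ | r < pker d α g q.1 q.2.1 * q.2.2} :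
        Set (ℝ × EuclideanSpace ℝ (Fin d) × ℝ)) =ᵐ[(volume.restrict (Ioc (0 : ℝ) t)).prod
          ((volume : Measure (EuclideanSpace ℝ (Fin d))).prod (lam.restrict (Ioi (0 : ℝ))))]
      {q : ℝ × EuclideanSpace ℝ (Fin d) × ℝ | r < pker d α g' q.1 q.2.1 * q.2.2} := by
    have h := Measure.quasiMeasurePreserving_fst
      (μ := volume.restrict (Ioc (0 : ℝ) t))
      (ν := (volume : Measure (EuclideanSpace ℝ (Fin d))).prod (lam.restrict (Ioi (0 : ℝ))))
      |>.ae (ae_restrict_mem measurableSet_Ioc)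
    filter_upwards [h] with q hq
    have hx : 0 ≤ ‖q.2.1‖ / q.1 ^ ((1 : ℝ) / α) := by
      have := hq.1
      positivity
    change (r < pker d α g q.1 q.2.1 * q.2.2) = (r < pker d α g' q.1 q.2.1 * q.2.2)
    simp only [pker, hg', max_eq_left hx]
  rw [etaBar, measure_congr hae, Measure.prod_apply hmeas, ← lintegral_const_mul' _ _
    measure_ball_lt_top.ne]
  refine setLIntegral_congr_fun measurableSet_Ioc fun s hs => ?_
  rw [Measure.prod_apply_symm (measurable_prodMk_left hmeas), ← mul_assoc,
    ← lintegral_const_mul' _ _ (ENNReal.mul_ne_top measure_ball_lt_top.ne ENNReal.ofReal_ne_top)]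
  refine setLIntegral_congr_fun measurableSet_Ioi fun z hz => ?_
  refine (volume_pker_slice hd hs.1 hr hz hG0 hG').trans ?_
  ring

lemma tendsto_setLIntegral_Ioc_atTop (f : ℝ → ℝ≥0∞) :
    Tendsto (fun x => ∫⁻ u in Ioc 0 x, f u) atTop (𝓝 (∫⁻ u in Ioi 0, f u)) := by
  have h := tendsto_measure_Iic_atTop ((volume.restrict (Ioi (0 : ℝ))).withDensity f)
  rw [withDensity_apply _ MeasurableSet.univ, Measure.restrict_univ] at h
  refine h.congr fun x => ?_
  rw [withDensity_apply _ measurableSet_Iic, Measure.restrict_restrict measurableSet_Iic,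
    inter_comm, Ioi_inter_Iic]

lemma setLIntegral_Ioi_div_eq {d : ℕ} (hd : 1 ≤ d) {g ginv : ℝ → ℝ} (hg0 : 0 < g 0)
    (lam : Measure ℝ) {u : ℝ} (hu : 0 < u) :
    ∫⁻ z in Ioi (u / g 0), ENNReal.ofReal (ginv (u / z) ^ d) ∂lam =
      ∫⁻ z in Ioi (0 : ℝ), ENNReal.ofReal (profileInv g ginv (u / z) ^ d) ∂lam := by
  have hug : 0 < u / g 0 := by positivity
  rw [← lintegral_indicator measurableSet_Ioi, ← lintegral_indicator measurableSet_Ioi]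
  congr 1
  ext z
  by_cases hz : 0 < z
  · rw [indicator_of_mem (s := Ioi (0 : ℝ)) hz]
    by_cases h : u / g 0 < z
    · have h' : u / z ∈ Ioo 0 (g 0) := ⟨by positivity, (div_lt_comm₀ hg0 hz).1 h⟩
      rw [indicator_of_mem (s := Ioi (u / g 0)) h, profileInv, indicator_of_mem h']
    · have h' : u / z ∉ Ioo 0 (g 0) := fun h' => h ((div_lt_comm₀ hg0 hz).2 h'.2)
      rw [indicator_of_notMem (s := Ioi (u / g 0)) h, profileInv, indicator_of_notMem h',
        zero_pow (by omega), ENNReal.ofReal_zero]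
  · rw [indicator_of_notMem (s := Ioi (0 : ℝ)) hz,
      indicator_of_notMem (s := Ioi (u / g 0)) fun h => hz (hug.trans h)]

lemma lintegral_rpow_mul_lintegral_comp_div {d : ℕ} (a : ℝ) {G : ℝ → ℝ} (hG : Measurable G)
    (lam : Measure ℝ) [SigmaFinite lam] :
    ∫⁻ u in Ioi (0 : ℝ), ENNReal.ofReal (u ^ a) *
        ∫⁻ z in Ioi (0 : ℝ), ENNReal.ofReal (G (u / z) ^ d) ∂lam =
      (∫⁻ z in Ioi (0 : ℝ), ENNReal.ofReal (z ^ (1 + a)) ∂lam) *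
        ∫⁻ v in Ioi (0 : ℝ), ENNReal.ofReal (v ^ a) * ENNReal.ofReal (G v ^ d) := by
  simp_rw [← lintegral_const_mul' _ _ ENNReal.ofReal_ne_top]
  rw [lintegral_lintegral_swap (by fun_prop), ← lintegral_mul_const _ (by fun_prop)]
  exact setLIntegral_congr_fun measurableSet_Ioi fun z hz =>
    lintegral_Ioi_rpow_mul_comp_div a (fun v => ENNReal.ofReal (G v ^ d)) hz

theorem stmt7 (d : ℕ) (hd : 1 ≤ d) (α : ℝ) (hα : α ∈ Set.Ioo (0:ℝ) 2) (t : ℝ) (ht : 0 < t)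
    (lam : MeasureTheory.Measure ℝ) [SigmaFinite lam]
    (hlam0 : lam (Set.Iic 0) = 0) (hlam_ne : lam ≠ 0)
    (hmom : ∫⁻ z in Set.Ioi (0:ℝ), ENNReal.ofReal (min 1 (z ^ 2)) ∂lam ≠ ⊤)
    (g : ℝ → ℝ) (hg_cont : ContinuousOn g (Set.Ici 0))
    (hg_anti : StrictAntiOn g (Set.Ici 0)) (hg_pos : ∀ x : ℝ, 0 ≤ x → 0 < g x)
    (c₀ : ℝ) (hc₀ : 0 < c₀)
    (hg_tail : Filter.Tendsto (fun r : ℝ => r ^ ((d:ℝ) + α) * g r) Filter.atTop (nhds c₀))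
    -- `ginv` is the inverse of `g : [0,∞) → (0, g(0)]`
    (ginv : ℝ → ℝ) (hginv_left : ∀ x : ℝ, 0 ≤ x → ginv (g x) = x)
    (hginv_right : ∀ u : ℝ, u ∈ Set.Ioc 0 (g 0) → g (ginv u) = u)
    -- assumption: `∫_{(0,∞)} z^{1+α/d} λ(dz) < ∞`
    (hint : ∫⁻ z in Set.Ioi (0:ℝ), ENNReal.ofReal (z ^ (1 + α / (d:ℝ))) ∂lam ≠ ⊤) :
    ∃ C : ℝ≥0∞,
      C = ENNReal.ofReal
            (α * (MeasureTheory.volume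
              (Metric.ball (0 : EuclideanSpace ℝ (Fin d)) 1)).toReal / (d:ℝ)) *
          ∫⁻ u in Set.Ioi (0:ℝ),
            ENNReal.ofReal (u ^ (α / (d:ℝ))) *
              ∫⁻ z in Set.Ioi (u / g 0), ENNReal.ofReal (ginv (u / z) ^ d) ∂lam ∧
      C ≠ ⊤ ∧ 0 < C ∧
      Filter.Tendsto
        (fun r : ℝ => (etaBar d α t g lam r).toReal / (C.toReal * r ^ (-(1 + α / (d:ℝ)))))
        Filter.atTop (nhds 1) := by
  obtain ⟨hα0, -⟩ := hα
  have hd0 : (0 : ℝ) < d := by exact_mod_cast hd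
  have hg0 : 0 < g 0 := hg_pos 0 le_rfl
  have hsurj : ∀ v ∈ Ioc 0 (g 0), ∃ x, 0 ≤ x ∧ g x = v := fun v hv =>
    exists_eq_of_mem_Ioc (by positivity) hg_cont hg_tail hv
  set G := profileInv g ginv
  set ω := volume (Metric.ball (0 : EuclideanSpace ℝ (Fin d)) 1) with hω
  have hω_top : ω ≠ ⊤ := measure_ball_lt_top.ne
  have hω_pos : 0 < ω := Metric.measure_ball_pos _ _ one_pos
  have hω_real : 0 < ω.toReal := ENNReal.toReal_pos hω_pos.ne' hω_top
  set f : ℝ → ℝ≥0∞ := fun u => ENNReal.ofReal (u ^ (α / (d : ℝ))) *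
    ∫⁻ z in Ioi (0 : ℝ), ENNReal.ofReal (G (u / z) ^ d) ∂lam with hf
  have hCf : ∫⁻ u in Ioi (0 : ℝ), ENNReal.ofReal (u ^ (α / (d : ℝ))) *
      ∫⁻ z in Ioi (u / g 0), ENNReal.ofReal (ginv (u / z) ^ d) ∂lam = ∫⁻ u in Ioi 0, f u :=
    setLIntegral_congr_fun measurableSet_Ioi fun u hu => by
      simp only [hf]
      rw [setLIntegral_Ioi_div_eq hd hg0 lam hu]
  rw [hCf]
  have hfact := lintegral_rpow_mul_lintegral_comp_div (d := d) (α / (d : ℝ))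
    (measurable_profileInv hg_anti hsurj hginv_left) lam
  have hmom_pos : 0 < ∫⁻ z in Ioi (0 : ℝ), ENNReal.ofReal (z ^ (1 + α / (d : ℝ))) ∂lam := by
    rw [setLIntegral_pos_iff (by fun_prop)]
    have hIoi : 0 < lam (Ioi 0) := by
      refine pos_iff_ne_zero.2 fun h => hlam_ne (Measure.measure_univ_eq_zero.1 ?_)
      rw [← Iic_union_Ioi (a := (0 : ℝ))]
      exact measure_union_null hlam0 h
    refine hIoi.trans_le (measure_mono fun z hz => ⟨?_, hz⟩)
    simpa using Real.rpow_pos_of_pos hz (1 + α / (d : ℝ))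
  have hJ_top : ∫⁻ u in Ioi 0, f u ≠ ⊤ := by
    rw [hfact]
    exact ENNReal.mul_ne_top hint
      (lintegral_profileInv_ne_top hd hα0 hg_anti hg_pos hg_tail hsurj hginv_left)
  have hJ_pos : 0 < ∫⁻ u in Ioi 0, f u := by
    rw [hfact]
    exact ENNReal.mul_pos hmom_pos.ne'
      (lintegral_profileInv_pos hg_anti hg_pos hsurj hginv_left).ne'
  have hK : 0 < α * ω.toReal / d := by positivity
  refine ⟨_, rfl, ENNReal.mul_ne_top ENNReal.ofReal_ne_top hJ_top,
    ENNReal.mul_pos (by simpa using hK) hJ_pos.ne', ?_⟩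
  set C := ENNReal.ofReal (α * ω.toReal / d) * ∫⁻ u in Ioi 0, f u with hC
  have hC_top : C ≠ ⊤ := ENNReal.mul_ne_top ENNReal.ofReal_ne_top hJ_top
  have hC_real : 0 < C.toReal :=
    ENNReal.toReal_pos (ENNReal.mul_pos (by simpa using hK) hJ_pos.ne').ne' hC_top
  have hb : 0 < (d : ℝ) / α := by positivity
  have hT : 0 < t ^ ((d : ℝ) / α) := by positivity
  have hlim : Tendsto (fun r : ℝ => ENNReal.ofReal (α * ω.toReal / d) *
      ∫⁻ u in Ioc 0 (r * t ^ ((d : ℝ) / α)), f u) atTop (𝓝 C) :=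
    ENNReal.Tendsto.const_mul ((tendsto_setLIntegral_Ioc_atTop f).comp
      (tendsto_id.atTop_mul_const hT)) (Or.inr ENNReal.ofReal_ne_top)
  have hlim' := ((ENNReal.tendsto_toReal hC_top).comp hlim).div_const C.toReal
  rw [div_self hC_real.ne'] at hlim'
  refine hlim'.congr' ?_
  filter_upwards [eventually_gt_atTop 0] with r hr
  have heta := etaBar_eq_lintegral (d := d) (α := α) (t := t) (G := G) lam hd hr hg_cont
    (profileInv_nonneg hsurj hginv_left)
    (fun v x hv hx => lt_profileInv_iff hg_anti hsurj hginv_left hv hx)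
  have hsub := lintegral_Ioc_rpow_mul_comp hb ht hr
    (fun u => ∫⁻ z in Ioi (0 : ℝ), ENNReal.ofReal (G (u / z) ^ d) ∂lam)
  rw [inv_div] at hsub
  have hrp : 0 < r ^ (1 + α / (d : ℝ)) := by positivity
  simp only [Function.comp_apply]
  rw [heta, hf, hsub, ← hω, Real.rpow_neg hr.le]
  simp only [ENNReal.toReal_mul]
  rw [ENNReal.toReal_ofReal hK.le, ENNReal.toReal_ofReal (by positivity)]
  generalize (∫⁻ s in Ioc 0 t, ENNReal.ofReal (s ^ ((d : ℝ) / α)) *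
    ∫⁻ z in Ioi (0 : ℝ), ENNReal.ofReal (G (r * s ^ ((d : ℝ) / α) / z) ^ d) ∂lam) = X
  field_simp
end

section
/- Assume ∫_{(0,1]} z^{1+α/d} λ(dz) < ∞ and ∫_{(1,∞)} z^{d/(d+α)} λ(dz) < ∞, and suppose there is a slowly varying function l at infinity with ∫_{1}^{∞} l(r)/r dr < ∞ such that λ̄(r) ≍ l(r)/r^{d/(d+α)} for r ≥ 1. Then η̄(r) ≍ r^{-d/(d+α)} ∫_{r}^{∞} l(u)/u du as r → ∞. -/
open MeasureTheory Set Filter Topology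
open scoped ENNReal NNReal

/-- `l : (0,∞) → (0,∞)` is slowly varying at infinity if `l(cr)/l(r) → 1` as `r → ∞`
for every `c > 0`. -/
def SlowlyVarying (l : ℝ → ℝ) : Prop :=
  ∀ c : ℝ, 0 < c → Filter.Tendsto (fun r => l (c * r) / l r) Filter.atTop (nhds 1)

theorem prod_prod_apply_of_sections {X Y Z : Type*} [MeasurableSpace X] [MeasurableSpace Y]
    [MeasurableSpace Z] (μ : Measure X) (ν : Measure Y) (ρ : Measure Z)
    [SFinite μ] [SFinite ν] [SFinite ρ] (I : Z → Set X) (B : Z → Set Y)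
    (hI : MeasurableSet {p : X × Z | p.1 ∈ I p.2})
    (hB : MeasurableSet {p : Y × Z | p.1 ∈ B p.2}) :
    (μ.prod (ν.prod ρ)) {q | q.1 ∈ I q.2.2 ∧ q.2.1 ∈ B q.2.2} =
      ∫⁻ z, μ (I z) * ν (B z) ∂ρ := by
  have hB' : Measurable fun z => ν (B z) := measurable_measure_prodMk_right hB
  have h1 : MeasurableSet {q : X × Y × Z | q.1 ∈ I q.2.2 ∧ q.2.1 ∈ B q.2.2} :=
    (hI.preimage (f := fun q : X × Y × Z => (q.1, q.2.2)) (by fun_prop)).inter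
      (hB.preimage (f := fun q : X × Y × Z => q.2) (by fun_prop))
  have key (x : X) (z : Z) : ν {y | x ∈ I z ∧ y ∈ B z} =
      ({p : X × Z | p.1 ∈ I p.2}.indicator (fun p => ν (B p.2))) (x, z) := by
    by_cases h : x ∈ I z <;> simp [h]
  have h2 (x : X) : ν.prod ρ {p | x ∈ I p.2 ∧ p.1 ∈ B p.2} =
      ∫⁻ z, ({p : X × Z | p.1 ∈ I p.2}.indicator (fun p => ν (B p.2))) (x, z) ∂ρ :=
    (Measure.prod_apply_symm (h1.preimage (measurable_prodMk_left (x := x)))).trans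
      (lintegral_congr fun z => key x z)
  rw [Measure.prod_apply h1]
  refine (lintegral_congr fun x => h2 x).trans ?_
  rw [lintegral_lintegral_swap]
  · refine lintegral_congr fun z => ?_
    have hz : MeasurableSet (I z) := hI.preimage (measurable_prodMk_right (y := z))
    rw [mul_comm, ← lintegral_indicator_const hz]
    rfl
  · exact ((hB'.comp measurable_snd).indicator hI).aemeasurable

theorem lintegral_Ioi_rpow_eq (ν : Measure ℝ) {κ r : ℝ} (hκ : 0 < κ) (hr : 0 < r) :
    ∫⁻ z in Ioi r, ENNReal.ofReal (z ^ κ) ∂ν =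
      ENNReal.ofReal (r ^ κ) * ν (Ioi r) +
        ENNReal.ofReal κ * ∫⁻ u in Ioi r, ν (Ioi u) * ENNReal.ofReal (u ^ (κ - 1)) := by
  rw [lintegral_rpow_eq_lintegral_meas_lt_mul (ν.restrict (Ioi r)) (f := fun z => z) ?_
    (by fun_prop) hκ]
  swap
  · filter_upwards [ae_restrict_mem measurableSet_Ioi] with z hz using (hr.trans hz).le
  have h (t : ℝ) : ν.restrict (Ioi r) {a | t < a} = ν (Ioi (max t r)) := by
    exact (Measure.restrict_apply measurableSet_Ioi).trans (congrArg ν Ioi_inter_Ioi)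
  simp_rw [h]
  rw [← Ioc_union_Ioi_eq_Ioi hr.le, lintegral_union measurableSet_Ioi
    (Set.disjoint_left.2 fun x hx hx' => not_lt.2 hx.2 hx'), mul_add]
  congr 1
  · have : ∫⁻ t in Ioc 0 r, ν (Ioi (max t r)) * ENNReal.ofReal (t ^ (κ - 1)) =
        ∫⁻ t in Ioc 0 r, ν (Ioi r) * ENNReal.ofReal (t ^ (κ - 1)) :=
      setLIntegral_congr_fun measurableSet_Ioc fun t ht => by simp [max_eq_right ht.2]
    have hint : IntegrableOn (fun t : ℝ => t ^ (κ - 1)) (Ioc 0 r) :=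
      (intervalIntegrable_iff_integrableOn_Ioc_of_le hr.le).1
        (intervalIntegral.intervalIntegrable_rpow' (by linarith))
    rw [this, lintegral_const_mul _ (by fun_prop), ← ofReal_integral_eq_lintegral_ofReal hint,
      ← intervalIntegral.integral_of_le hr.le, integral_rpow (Or.inl (by linarith)),
      mul_left_comm, ← ENNReal.ofReal_mul hκ.le, mul_comm (ν _)]
    · congr 2
      simp [Real.zero_rpow hκ.ne']
      field_simp
    · filter_upwards [ae_restrict_mem measurableSet_Ioc] with z hz
      exact Real.rpow_nonneg hz.1.le _
  · congr 1
    exact setLIntegral_congr_fun measurableSet_Ioi fun t ht => by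
      simp [max_eq_left (mem_Ioi.1 ht).le]

theorem lintegral_Ioc_div_rpow_le_measure_Ioi (ν : Measure ℝ) {β a r : ℝ} (hβ : 0 < β)
    (ha : 0 ≤ a) (hr : 0 < r) :
    ∫⁻ z in Ioc a r, ENNReal.ofReal ((z / r) ^ β) ∂ν ≤ ν (Ioi a) := by
  calc ∫⁻ z in Ioc a r, ENNReal.ofReal ((z / r) ^ β) ∂ν
      ≤ ∫⁻ z in Ioc a r, 1 ∂ν := by
        refine setLIntegral_mono' measurableSet_Ioc fun z hz => ?_
        rw [ENNReal.ofReal_le_one]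
        have : 0 < z := ha.trans_lt hz.1
        exact Real.rpow_le_one (by positivity) ((div_le_one hr).2 hz.2) hβ.le
    _ = ν (Ioc a r) := by simp
    _ ≤ ν (Ioi a) := measure_mono Ioc_subset_Ioi_self

theorem lintegral_Ioc_div_rpow_two_mul_le (ν : Measure ℝ) {β r : ℝ} (hβ : 0 < β) (hr : 0 < r) :
    ∫⁻ z in Ioc 0 (2 * r), ENNReal.ofReal ((z / (2 * r)) ^ β) ∂ν ≤
      ENNReal.ofReal ((2 : ℝ) ^ (-β)) * ∫⁻ z in Ioc 0 r, ENNReal.ofReal ((z / r) ^ β) ∂ν +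
        ν (Ioi r) := by
  rw [← Ioc_union_Ioc_eq_Ioc hr.le (by linarith : r ≤ 2 * r), lintegral_union measurableSet_Ioc
    (Set.disjoint_left.2 fun x hx hx' => not_lt.2 hx.2 hx'.1)]
  gcongr
  · rw [← lintegral_const_mul _ (by fun_prop)]
    refine setLIntegral_mono' measurableSet_Ioc fun z hz => ?_
    rw [← ENNReal.ofReal_mul (by positivity)]
    apply ENNReal.ofReal_le_ofReal
    have hz0 : 0 ≤ z / r := div_nonneg hz.1.le hr.le
    rw [Real.rpow_neg zero_le_two, ← Real.inv_rpow zero_le_two, ← Real.mul_rpow (by norm_num) hz0]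
    apply le_of_eq
    congr 1
    field_simp
  · exact lintegral_Ioc_div_rpow_le_measure_Ioi ν hβ hr.le (by positivity)

theorem exists_lintegral_Ioc_div_rpow_le (ν : Measure ℝ) {M : ℝ → ℝ} {A B R m β : ℝ}
    (hβ : 0 < β) (hR : 0 < R) (hm : 0 < m) (hmβ : m * 2 ^ (-β) < 1) (hA : 0 ≤ A)
    (hM0 : ∀ r, R ≤ r → 0 ≤ M r) (hM : ∀ r, R ≤ r → M r ≤ m * M (2 * r))
    (hν : ∀ r, R ≤ r → ν (Ioi r) ≤ ENNReal.ofReal (A * M r))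
    (hB : ∀ r ∈ Icc R (2 * R),
      ∫⁻ z in Ioc 0 r, ENNReal.ofReal ((z / r) ^ β) ∂ν ≤ ENNReal.ofReal (B * M r)) :
    ∃ K, 0 ≤ K ∧ ∀ r, R ≤ r →
      ∫⁻ z in Ioc 0 r, ENNReal.ofReal ((z / r) ^ β) ∂ν ≤ ENNReal.ofReal (K * M r) := by
  have hq : 0 < 1 - m * 2 ^ (-β) := by linarith
  set q : ℝ := 2 ^ (-β) with hqdef
  have hq0 : 0 < q := by positivity
  set K := max B (A * m / (1 - m * q)) with hK
  have hK0 : 0 ≤ K := le_max_of_le_right (by positivity)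
  have hK1 : (q * K + A) * m ≤ K := by
    have : A * m / (1 - m * q) ≤ K := le_max_right _ _
    rw [div_le_iff₀ hq] at this
    linarith
  refine ⟨K, hK0, ?_⟩
  have key : ∀ n : ℕ, ∀ r ∈ Icc R (2 ^ (n + 1) * R),
      ∫⁻ z in Ioc 0 r, ENNReal.ofReal ((z / r) ^ β) ∂ν ≤ ENNReal.ofReal (K * M r) := by
    intro n
    induction n with
    | zero =>
      intro r hr
      refine (hB r (by simpa using hr)).trans (ENNReal.ofReal_le_ofReal ?_)
      exact mul_le_mul_of_nonneg_right (le_max_left _ _) (hM0 r hr.1)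
    | succ n ih =>
      intro r hr
      by_cases h : r ≤ 2 * R
      · refine (hB r ⟨hr.1, h⟩).trans (ENNReal.ofReal_le_ofReal ?_)
        exact mul_le_mul_of_nonneg_right (le_max_left _ _) (hM0 r hr.1)
      · push Not at h
        obtain ⟨x, rfl⟩ : ∃ x, r = 2 * x := ⟨r / 2, by ring⟩
        have hx : R ≤ x := by linarith
        have hx2 : x ≤ 2 ^ (n + 1) * R := by
          have := hr.2
          rw [pow_succ] at this
          linarith
        refine (lintegral_Ioc_div_rpow_two_mul_le ν hβ (hR.trans_le hx)).trans ?_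
        calc _ ≤ ENNReal.ofReal q * ENNReal.ofReal (K * M x) + ENNReal.ofReal (A * M x) := by
              gcongr
              · exact ih x ⟨hx, hx2⟩
              · exact hν x hx
          _ = ENNReal.ofReal ((q * K + A) * M x) := by
              have := hM0 x hx
              rw [← ENNReal.ofReal_mul hq0.le, ← ENNReal.ofReal_add (by positivity)
                (by positivity)]
              congr 1
              ring
          _ ≤ _ := by
              apply ENNReal.ofReal_le_ofReal
              calc (q * K + A) * M x ≤ (q * K + A) * (m * M (2 * x)) := by
                    gcongr
                    exact hM x hx
                _ = (q * K + A) * m * M (2 * x) := by ring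
                _ ≤ K * M (2 * x) := by
                    gcongr
                    exact hM0 _ (by linarith)
  intro r hr
  obtain ⟨n, hn⟩ := pow_unbounded_of_one_lt (r / R) (one_lt_two (α := ℝ))
  refine key n r ⟨hr, ?_⟩
  rw [div_lt_iff₀ hR] at hn
  rw [pow_succ]
  nlinarith

theorem SlowlyVarying.tail_le_mul_tail_two_mul {l : ℝ → ℝ} (hl : SlowlyVarying l)
    (hl_pos : ∀ x : ℝ, 0 < x → 0 < l x) (hl_int : IntegrableOn (fun u => l u / u) (Ioi 1))
    {K : ℝ} (hK : 1 < K) :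
    ∀ᶠ r in atTop, ∫ u in Ioi r, l u / u ≤ K * ∫ u in Ioi (2 * r), l u / u := by
  have h1 := (hl 2 two_pos).eventually_const_le (inv_lt_one_of_one_lt₀ hK)
  obtain ⟨R, hR⟩ := eventually_atTop.1 h1
  filter_upwards [eventually_ge_atTop R, eventually_ge_atTop 1] with r hrR hr1
  have hint2 : IntegrableOn (fun u => l (2 * u) / (2 * u)) (Ioi r) :=
    (integrableOn_Ioi_comp_mul_left_iff (fun u => l u / u) r two_pos).2
      (hl_int.mono_set (Ioi_subset_Ioi (by linarith)))
  have hcv := integral_comp_mul_left_Ioi (fun u => l u / u) r two_pos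
  calc ∫ u in Ioi r, l u / u ≤ ∫ u in Ioi r, (2 * K) * (l (2 * u) / (2 * u)) := by
        refine setIntegral_mono_on (hl_int.mono_set (Ioi_subset_Ioi hr1)) (hint2.const_mul _)
          measurableSet_Ioi fun u hu => ?_
        have hu0 : 0 < u := by have := mem_Ioi.1 hu; linarith
        have h := hR u (hrR.trans (le_of_lt hu))
        have hlu := hl_pos u hu0
        rw [le_div_iff₀ hlu, inv_mul_le_iff₀ (by linarith)] at h
        have : 2 * K * (l (2 * u) / (2 * u)) = (K * l (2 * u)) / u := by field_simp
        rw [this]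
        gcongr
    _ = K * ∫ u in Ioi (2 * r), l u / u := by
        rw [integral_const_mul, hcv, smul_eq_mul]
        ring

theorem rpow_mul_le_tail {l F : ℝ → ℝ} {κ C x : ℝ} (hκ : 0 ≤ κ) (hC : 0 < C) (hx : 1 ≤ x)
    (hl_pos : ∀ x : ℝ, 0 < x → 0 < l x) (hl_int : IntegrableOn (fun u => l u / u) (Ioi 1))
    (hF : ∀ r, 1 ≤ r → F r ≤ C * (l r / r ^ κ)) (hF0 : ∀ r, 0 ≤ F r)
    (hanti : AntitoneOn F (Ici 1)) :
    x ^ κ * F (2 * x) ≤ 2 * C * ∫ u in Ioi x, l u / u := by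
  have hx0 : 0 < x := by linarith
  have hI := hl_int.mono_set (Ioi_subset_Ioi hx)
  have h1 : ∫ u in Ioc x (2 * x), l u / u ≤ ∫ u in Ioi x, l u / u := by
    refine setIntegral_mono_set hI ?_ Ioc_subset_Ioi_self.eventuallyLE
    filter_upwards [ae_restrict_mem measurableSet_Ioi] with u hu
    have hu0 : 0 < u := hx0.trans hu
    exact (div_pos (hl_pos u hu0) hu0).le
  have h2 : ∫ u in Ioc x (2 * x), (C⁻¹ * (x ^ κ * F (2 * x)) / (2 * x)) ≤
      ∫ u in Ioc x (2 * x), l u / u := by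
    refine setIntegral_mono_on (integrableOn_const (by simp)) (hI.mono_set Ioc_subset_Ioi_self)
      measurableSet_Ioc fun u hu => ?_
    have hu0 : 0 < u := hx0.trans hu.1
    have hu1 : 1 ≤ u := hx.trans hu.1.le
    have h3 : F (2 * x) ≤ F u := hanti hu1 (mem_Ici.2 (by linarith)) hu.2
    have h4 : u ^ κ * F u ≤ C * l u := by
      have := hF u hu1
      rw [← mul_div_assoc, le_div_iff₀ (by positivity)] at this
      linarith
    have h5 : x ^ κ * F (2 * x) ≤ C * l u := by
      refine le_trans ?_ h4
      have := hF0 (2 * x)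
      gcongr
      exact hu.1.le
    have h6 := hl_pos u hu0
    have h7 : C⁻¹ * (x ^ κ * F (2 * x)) ≤ l u := by rwa [inv_mul_le_iff₀ hC]
    gcongr
    exact hu.2
  rw [setIntegral_const] at h2
  simp only [Measure.real, Real.volume_Ioc, smul_eq_mul] at h2
  rw [show 2 * x - x = x by ring, ENNReal.toReal_ofReal hx0.le] at h2
  have h8 := h2.trans h1
  have h9 : x * (C⁻¹ * (x ^ κ * F (2 * x)) / (2 * x)) = (x ^ κ * F (2 * x)) / (2 * C) := by
    field_simp
  rw [h9, div_le_iff₀ (by positivity)] at h8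
  linarith

theorem exists_rpow_mul_le_of_tendsto {g : ℝ → ℝ} {p c : ℝ} (hp : 0 < p)
    (hg_anti : AntitoneOn g (Ici 0)) (hg_pos : ∀ x : ℝ, 0 ≤ x → 0 < g x)
    (hg : Tendsto (fun r : ℝ => r ^ p * g r) atTop (𝓝 c)) :
    ∃ G, 0 < G ∧ ∀ x, 0 ≤ x → x ^ p * g x < G := by
  obtain ⟨R, hR⟩ := eventually_atTop.1 (hg.eventually_lt_const (lt_add_one c))
  set R' := max R 1
  have hR' : 0 < R' := lt_of_lt_of_le one_pos (le_max_right _ _)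
  have hg0 := hg_pos 0 le_rfl
  refine ⟨max (c + 1) (R' ^ p * g 0 + 1), lt_max_of_lt_right (by positivity), fun x hx => ?_⟩
  rcases le_total R' x with h | h
  · exact lt_max_of_lt_left (hR x ((le_max_left _ _).trans h))
  · refine lt_max_of_lt_right (lt_of_le_of_lt ?_ (lt_add_one _))
    have := hg_pos x hx
    gcongr
    exact hg_anti self_mem_Ici hx hx

theorem norm_rpow_le_and_le_of_one_lt_pker {d : ℕ} (hd : 1 ≤ d) {α : ℝ} (hα : 0 < α)
    {g : ℝ → ℝ} (hg_anti : AntitoneOn g (Ici 0)) (hg_pos : ∀ x : ℝ, 0 ≤ x → 0 < g x)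
    {G : ℝ} (hG : ∀ x, 0 ≤ x → x ^ ((d : ℝ) + α) * g x < G) {s w : ℝ} (hs : 0 < s) (hw : 0 < w)
    {y : EuclideanSpace ℝ (Fin d)} (h : 1 < pker d α g s y * w) :
    ‖y‖ ^ ((d : ℝ) + α) ≤ G * s * w ∧ s ≤ (g 0 * w) ^ (α / (d : ℝ)) := by
  have hd0 : (0 : ℝ) < d := by exact_mod_cast hd
  unfold pker at h
  set x := ‖y‖ / s ^ ((1 : ℝ) / α) with hx
  have hx0 : 0 ≤ x := by positivity
  have hgx := hg_pos x hx0
  have hsd : 0 < s ^ ((d : ℝ) / α) := by positivity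
  have h1 : s ^ ((d : ℝ) / α) < g x * w := by
    rw [Real.rpow_neg hs.le, mul_assoc, ← div_eq_inv_mul, one_lt_div hsd] at h
    exact h
  constructor
  · have hy : ‖y‖ = x * s ^ ((1 : ℝ) / α) := by rw [hx]; field_simp
    have h2 : ‖y‖ ^ ((d : ℝ) + α) = x ^ ((d : ℝ) + α) * s ^ ((d : ℝ) / α) * s := by
      rw [hy, Real.mul_rpow hx0 (by positivity), ← Real.rpow_mul hs.le, mul_assoc]
      congr 1
      rw [← Real.rpow_add_one hs.ne']
      congr 1
      field_simp
    rw [h2]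
    calc x ^ ((d : ℝ) + α) * s ^ ((d : ℝ) / α) * s
        ≤ x ^ ((d : ℝ) + α) * (g x * w) * s := by gcongr
      _ = (x ^ ((d : ℝ) + α) * g x) * s * w := by ring
      _ ≤ G * s * w := by gcongr; exact (hG x hx0).le
  · have h3 : s ^ ((d : ℝ) / α) ≤ g 0 * w :=
      h1.le.trans (by gcongr; exact hg_anti self_mem_Ici hx0 hx0)
    calc s = (s ^ ((d : ℝ) / α)) ^ (α / (d : ℝ)) := by
          rw [← Real.rpow_mul hs.le]
          field_simp
          simp
      _ ≤ _ := by gcongr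

theorem volume_closedBall_rpow_mul {d : ℕ} {a w p : ℝ} (ha : 0 ≤ a) (hw : 0 ≤ w) :
    (volume : Measure (EuclideanSpace ℝ (Fin d))).real
        (Metric.closedBall 0 (a * w ^ p)) =
      a ^ d * (volume : Measure (EuclideanSpace ℝ (Fin d))).real (Metric.ball 0 1) *
        w ^ (p * d) := by
  rw [Measure.real, Measure.addHaar_closedBall _ _ (by positivity), finrank_euclideanSpace_fin,
    ENNReal.toReal_mul, ENNReal.toReal_ofReal (by positivity), mul_pow, Real.rpow_mul hw,
    Real.rpow_natCast, Measure.real]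
  ring

theorem measurableSet_mem_closedBall {E : Type*} [NormedAddCommGroup E] [MeasurableSpace E]
    [OpensMeasurableSpace E] {b : ℝ → ℝ} (hb : Measurable b) :
    MeasurableSet {p : E × ℝ | p.1 ∈ Metric.closedBall 0 (b p.2)} := by
  simp only [Metric.mem_closedBall, dist_zero_right]
  exact measurableSet_le (by fun_prop) (by fun_prop)

/-- The mass of `{p_s(y) z > r}` coming from `z > r`, bounded from below. -/
theorem exists_le_etaBar {d : ℕ} (hd : 1 ≤ d) {α t : ℝ} (hα : 0 < α) (ht : 0 < t)
    (lam : Measure ℝ) [SigmaFinite lam]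
    {g : ℝ → ℝ} (hg_anti : AntitoneOn g (Ici 0))
    {c₀ : ℝ} (hc₀ : 0 < c₀)
    (hg_tail : Tendsto (fun r : ℝ => r ^ ((d:ℝ) + α) * g r) atTop (𝓝 c₀)) :
    ∃ c, 0 < c ∧ ∀ r, 0 < r →
      ENNReal.ofReal c *
        ∫⁻ z in Ioi r, ENNReal.ofReal ((z / r) ^ ((d : ℝ) / ((d : ℝ) + α))) ∂lam ≤
        etaBar d α t g lam r := by
  have hd0 : (0 : ℝ) < d := by exact_mod_cast hd
  obtain ⟨R₁, hR₁⟩ := eventually_atTop.1 (hg_tail.eventually_const_lt (half_lt_self hc₀))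
  set R := max R₁ 1
  have hR1 : 1 ≤ R := le_max_right _ _
  have hR0 : 0 < R := by linarith
  have hRg : ∀ x, R ≤ x → c₀ / 2 < x ^ ((d:ℝ) + α) * g x :=
    fun x hx => hR₁ x ((le_max_left _ _).trans hx)
  set e := c₀ / 2 / R ^ ((d : ℝ) + α) with he
  have he0 : 0 < e := by positivity
  obtain ⟨s₀, hs₀, hst, hs₀e⟩ : ∃ s₀, 0 < s₀ ∧ s₀ ≤ t ∧ 1 ≤ s₀ ^ (-((d : ℝ) / α)) * e := by
    refine ⟨min t (e ^ (α / (d : ℝ))), by positivity, min_le_left _ _, ?_⟩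
    have h1 : (min t (e ^ (α / (d : ℝ)))) ^ ((d : ℝ) / α) ≤ e := by
      calc _ ≤ (e ^ (α / (d : ℝ))) ^ ((d : ℝ) / α) := by gcongr; exact min_le_right _ _
        _ = e := by
          rw [← Real.rpow_mul he0.le]
          field_simp
          simp
    rw [Real.rpow_neg (by positivity), ← div_eq_inv_mul, one_le_div (by positivity)]
    exact h1
  set ε := R * (s₀ / 2) ^ ((1 : ℝ) / α) with hε
  have hε0 : 0 < ε := by positivity
  set v := (volume : Measure (EuclideanSpace ℝ (Fin d))).real (Metric.ball 0 1) with hv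
  have hv0 : 0 < v := ENNReal.toReal_pos (Metric.measure_ball_pos _ _ one_pos).ne'
    measure_ball_lt_top.ne
  refine ⟨s₀ / 2 * (ε ^ d * v), by positivity, fun r hr => ?_⟩
  set b : ℝ → ℝ := fun z => ε * (z / r) ^ (1 / ((d : ℝ) + α)) with hb
  have hbm : Measurable b := by fun_prop
  set I : ℝ → Set ℝ := fun z => {s | s ∈ Ioc (s₀ / 2) s₀ ∧ z ∈ Ioi r} with hI
  have hIm : MeasurableSet {p : ℝ × ℝ | p.1 ∈ I p.2} :=
    (measurableSet_Ioc.preimage measurable_fst).inter (measurableSet_Ioi.preimage measurable_snd)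
  have hsub : {q : ℝ × EuclideanSpace ℝ (Fin d) × ℝ |
      q.1 ∈ I q.2.2 ∧ q.2.1 ∈ Metric.closedBall 0 (b q.2.2)} ⊆
      {q | r < pker d α g q.1 q.2.1 * q.2.2} := by
    rintro ⟨s, y, z⟩ ⟨⟨hs, hz⟩, hy⟩
    simp only [mem_Ioc, mem_Ioi, Metric.mem_closedBall, dist_zero_right, mem_ofPred_eq]
      at hs hz hy ⊢
    have hs0 : 0 < s := by linarith
    have hw : 1 ≤ z / r := by rw [one_le_div hr]; exact hz.le
    set w := z / r with hwdef
    have hw0 : 0 < w := by linarith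
    have hzw : z = w * r := by rw [hwdef]; field_simp
    set X := R * w ^ (1 / ((d : ℝ) + α)) with hX
    have hXR : R ≤ X := le_mul_of_one_le_right hR0.le (Real.one_le_rpow hw (by positivity))
    have hyX : ‖y‖ / s ^ ((1 : ℝ) / α) ≤ X := by
      rw [div_le_iff₀ (by positivity)]
      calc ‖y‖ ≤ b z := hy
        _ = X * (s₀ / 2) ^ ((1 : ℝ) / α) := by rw [hb, hX, hε]; ring
        _ ≤ X * s ^ ((1 : ℝ) / α) := by
          have : 0 < X := by positivity
          gcongr
          exact hs.1.le
    have hgX : g X ≤ g (‖y‖ / s ^ ((1 : ℝ) / α)) :=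
      hg_anti (mem_Ici.2 (by positivity)) (mem_Ici.2 (by positivity)) hyX
    have hXp : X ^ ((d : ℝ) + α) = R ^ ((d : ℝ) + α) * w := by
      rw [hX, Real.mul_rpow hR0.le (by positivity), ← Real.rpow_mul hw0.le]
      field_simp
      simp
    have hgX2 : e < g X * w := by
      have := hRg X hXR
      rw [hXp] at this
      rw [he, div_lt_iff₀ (by positivity)]
      linarith
    have hss : s₀ ^ (-((d : ℝ) / α)) ≤ s ^ (-((d : ℝ) / α)) :=
      Real.rpow_le_rpow_of_nonpos hs0 hs.2 (by rw [neg_nonpos]; positivity)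
    have h1 : 1 < s ^ (-((d : ℝ) / α)) * (g X * w) :=
      calc 1 ≤ s₀ ^ (-((d : ℝ) / α)) * e := hs₀e
        _ ≤ s ^ (-((d : ℝ) / α)) * e := by gcongr
        _ < _ := by gcongr
    calc r < s ^ (-((d : ℝ) / α)) * (g X * w) * r := lt_mul_of_one_lt_left hr h1
      _ = s ^ (-((d : ℝ) / α)) * g X * z := by rw [hzw]; ring
      _ ≤ pker d α g s y * z := by
        unfold pker
        have : 0 < z := hr.trans hz
        gcongr
  refine le_trans ?_ (measure_mono hsub)
  rw [prod_prod_apply_of_sections _ _ _ I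
    (fun z => Metric.closedBall 0 (b z)) hIm (measurableSet_mem_closedBall hbm),
    ← lintegral_const_mul _ (by fun_prop)]
  refine le_trans ?_ (lintegral_mono_set' (Ioi_subset_Ioi hr.le).eventuallyLE)
  refine setLIntegral_mono' measurableSet_Ioi fun z hz => ?_
  have hw : 0 ≤ z / r := div_nonneg (hr.trans hz).le hr.le
  have hIz : I z = Ioc (s₀ / 2) s₀ := by ext s; simp [hI, mem_Ioi.1 hz]
  rw [hIz, Measure.restrict_apply measurableSet_Ioc, inter_eq_left.2
    (Ioc_subset_Ioc (by positivity) hst), Real.volume_Ioc,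
    ← ofReal_measureReal (measure_closedBall_lt_top.ne), volume_closedBall_rpow_mul hε0.le hw,
    ← ENNReal.ofReal_mul (by positivity), ← ENNReal.ofReal_mul (by linarith)]
  apply ENNReal.ofReal_le_ofReal
  apply le_of_eq
  rw [← hv, one_div_mul_eq_div]
  ring

/-- The mass of `{p_s(y) z > r}`, bounded from above separately on `z > r` and on `z ≤ r`. -/
theorem exists_etaBar_le {d : ℕ} (hd : 1 ≤ d) {α t : ℝ} (hα : 0 < α) (ht : 0 < t)
    (lam : Measure ℝ) [SigmaFinite lam]
    {g : ℝ → ℝ} (hg_anti : AntitoneOn g (Ici 0)) (hg_pos : ∀ x : ℝ, 0 ≤ x → 0 < g x)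
    {c₀ : ℝ} (hg_tail : Tendsto (fun r : ℝ => r ^ ((d:ℝ) + α) * g r) atTop (𝓝 c₀)) :
    ∃ C, 0 < C ∧ ∀ r, 0 < r → etaBar d α t g lam r ≤
      ENNReal.ofReal C * (
        ∫⁻ z in Ioi r, ENNReal.ofReal ((z / r) ^ ((d : ℝ) / ((d : ℝ) + α))) ∂lam +
        ∫⁻ z in Ioc 0 r, ENNReal.ofReal ((z / r) ^ (1 + α / (d : ℝ))) ∂lam) := by
  have hd0 : (0 : ℝ) < d := by exact_mod_cast hd
  obtain ⟨G, hG0, hG⟩ := exists_rpow_mul_le_of_tendsto (by positivity) hg_anti hg_pos hg_tail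
  have hg0 := hg_pos 0 le_rfl
  set v := (volume : Measure (EuclideanSpace ℝ (Fin d))).real (Metric.ball 0 1) with hv
  have hv0 : 0 < v := ENNReal.toReal_pos (Metric.measure_ball_pos _ _ one_pos).ne'
    measure_ball_lt_top.ne
  set k₁ := (G * t) ^ (1 / ((d : ℝ) + α)) with hk₁
  set k₂ := (G * g 0 ^ (α / (d : ℝ))) ^ (1 / ((d : ℝ) + α)) with hk₂
  set C₁ := t * (k₁ ^ d * v) with hC₁
  set C₂ := g 0 ^ (α / (d : ℝ)) * (k₂ ^ d * v) with hC₂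
  have hC₁0 : 0 < C₁ := by positivity
  have hC₂0 : 0 < C₂ := by positivity
  refine ⟨max C₁ C₂, by positivity, fun r hr => ?_⟩
  set b₁ : ℝ → ℝ := fun z => k₁ * (z / r) ^ (1 / ((d : ℝ) + α)) with hb₁
  set b₂ : ℝ → ℝ := fun z => k₂ * (z / r) ^ (1 / (d : ℝ)) with hb₂
  set a : ℝ → ℝ := fun z => (g 0 * (z / r)) ^ (α / (d : ℝ)) with ha
  have hbm₁ : Measurable b₁ := by fun_prop
  have hbm₂ : Measurable b₂ := by fun_prop
  have ham : Measurable a := by fun_prop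
  set I₁ : ℝ → Set ℝ := fun z => {s | s ∈ Ioc 0 t ∧ z ∈ Ioi r} with hI₁
  set I₂ : ℝ → Set ℝ := fun z => {s | s ∈ Ioc 0 (a z) ∧ z ∈ Ioc 0 r} with hI₂
  have hIm₁ : MeasurableSet {p : ℝ × ℝ | p.1 ∈ I₁ p.2} :=
    (measurableSet_Ioc.preimage measurable_fst).inter (measurableSet_Ioi.preimage measurable_snd)
  have hIm₂ : MeasurableSet {p : ℝ × ℝ | p.1 ∈ I₂ p.2} := by
    refine MeasurableSet.inter ?_ (measurableSet_Ioc.preimage measurable_snd)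
    exact (measurableSet_lt measurable_const measurable_fst).inter
      (measurableSet_le measurable_fst (ham.comp measurable_snd))
  set μ := ((volume.restrict (Set.Ioc (0:ℝ) t)).prod
      ((volume : Measure (EuclideanSpace ℝ (Fin d))).prod (lam.restrict (Set.Ioi (0:ℝ)))))
    with hμ
  have hae : ∀ᵐ q ∂μ, q.1 ∈ Ioc 0 t ∧ q.2.2 ∈ Ioi (0:ℝ) := by
    have h1 : ∀ᵐ s ∂(volume.restrict (Set.Ioc (0:ℝ) t)), s ∈ Ioc 0 t :=
      ae_restrict_mem measurableSet_Ioc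
    have h2 : ∀ᵐ z ∂(lam.restrict (Set.Ioi (0:ℝ))), z ∈ Ioi (0:ℝ) :=
      ae_restrict_mem measurableSet_Ioi
    exact (Measure.quasiMeasurePreserving_fst.ae h1).and
      (Measure.quasiMeasurePreserving_snd.ae (Measure.quasiMeasurePreserving_snd.ae h2))
  have hsub : {q : ℝ × EuclideanSpace ℝ (Fin d) × ℝ | r < pker d α g q.1 q.2.1 * q.2.2} ≤ᵐ[μ]
      ({q : ℝ × EuclideanSpace ℝ (Fin d) × ℝ |
        q.1 ∈ I₁ q.2.2 ∧ q.2.1 ∈ Metric.closedBall 0 (b₁ q.2.2)} ∪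
      {q : ℝ × EuclideanSpace ℝ (Fin d) × ℝ |
        q.1 ∈ I₂ q.2.2 ∧ q.2.1 ∈ Metric.closedBall 0 (b₂ q.2.2)} : Set _) := by
    filter_upwards [hae]
    rintro ⟨s, y, z⟩ ⟨hs, hz⟩ hq
    change r < pker d α g s y * z at hq
    change 0 < z at hz
    change 0 < s ∧ s ≤ t at hs
    have hw : 0 < z / r := by positivity
    have h1 : 1 < pker d α g s y * (z / r) := by
      rw [← mul_div_assoc, one_lt_div hr]; exact hq
    obtain ⟨hy, hs'⟩ := norm_rpow_le_and_le_of_one_lt_pker hd hα hg_anti hg_pos hG hs.1 hw h1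
    have hroot : ∀ Q, ‖y‖ ^ ((d : ℝ) + α) ≤ Q → ‖y‖ ≤ Q ^ (1 / ((d : ℝ) + α)) := by
      intro Q hQ
      calc ‖y‖ = (‖y‖ ^ ((d : ℝ) + α)) ^ (1 / ((d : ℝ) + α)) := by
            rw [← Real.rpow_mul (norm_nonneg _)]
            field_simp
            simp
        _ ≤ _ := by gcongr
    rcases lt_or_ge r z with hzr | hzr
    · refine Or.inl ⟨⟨hs, hzr⟩, ?_⟩
      rw [Metric.mem_closedBall, dist_zero_right]
      refine (hroot _ (hy.trans ?_)).trans
        (Real.mul_rpow (x := G * t) (by positivity) hw.le).le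
      gcongr
      exact hs.2
    · refine Or.inr ⟨⟨⟨hs.1, hs'⟩, hz, hzr⟩, ?_⟩
      rw [Metric.mem_closedBall, dist_zero_right]
      refine (hroot (G * g 0 ^ (α / (d : ℝ)) * (z / r) ^ (α / (d : ℝ) + 1)) (hy.trans ?_)).trans ?_
      · rw [Real.rpow_add_one hw.ne']
        calc G * s * (z / r) ≤ G * ((g 0 * (z / r)) ^ (α / (d : ℝ))) * (z / r) := by gcongr
          _ = _ := by rw [Real.mul_rpow hg0.le hw.le]; ring
      · rw [Real.mul_rpow (by positivity) (by positivity), ← Real.rpow_mul hw.le]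
        apply le_of_eq
        simp only [hb₂, hk₂]
        congr 2
        field_simp
        ring
  change μ _ ≤ _
  refine (measure_mono_ae hsub).trans ((measure_union_le _ _).trans ?_)
  rw [mul_add, hμ, prod_prod_apply_of_sections _ _ _ I₁
      (fun z => Metric.closedBall 0 (b₁ z)) hIm₁ (measurableSet_mem_closedBall hbm₁),
    prod_prod_apply_of_sections _ _ _ I₂
      (fun z => Metric.closedBall 0 (b₂ z)) hIm₂ (measurableSet_mem_closedBall hbm₂)]
  gcongr
  · rw [← lintegral_const_mul _ (by fun_prop), ← lintegral_indicator (measurableSet_Ioi (a := r))]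
    refine (lintegral_mono' Measure.restrict_le_self le_rfl).trans (lintegral_mono fun z => ?_)
    by_cases hz : z ∈ Ioi r
    · rw [indicator_of_mem hz]
      have hw : 0 ≤ z / r := div_nonneg (hr.trans hz).le hr.le
      have hIz : I₁ z = Ioc 0 t := by ext s; simp [hI₁, mem_Ioi.1 hz]
      rw [hIz, Measure.restrict_apply measurableSet_Ioc, inter_self, Real.volume_Ioc, sub_zero,
        ← ofReal_measureReal (measure_closedBall_lt_top.ne),
        volume_closedBall_rpow_mul (by positivity) hw,
        ← ENNReal.ofReal_mul (by positivity), ← ENNReal.ofReal_mul (by positivity)]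
      apply ENNReal.ofReal_le_ofReal
      rw [← hv, one_div_mul_eq_div]
      calc _ = C₁ * (z / r) ^ ((d : ℝ) / ((d : ℝ) + α)) := by rw [hC₁]; ring
        _ ≤ _ := by gcongr; exact le_max_left _ _
    · have : I₁ z = ∅ := by ext s; simp [hI₁, not_lt.1 (mt mem_Ioi.2 hz)]
      simp [this]
  · rw [← lintegral_const_mul _ (by fun_prop), ← lintegral_indicator (measurableSet_Ioc (a := 0) (b := r))]
    refine (lintegral_mono' Measure.restrict_le_self le_rfl).trans (lintegral_mono fun z => ?_)
    by_cases hz : z ∈ Ioc 0 r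
    · rw [indicator_of_mem hz]
      have hw : 0 < z / r := div_pos hz.1 hr
      have hIz : I₂ z = Ioc 0 (a z) := by ext s; simp [hI₂, hz.1, hz.2]
      have ha0 : 0 ≤ a z := by positivity
      rw [hIz]
      refine (mul_le_mul_left (Measure.restrict_apply_le _ _) _).trans ?_
      rw [Real.volume_Ioc, sub_zero,
        ← ofReal_measureReal (measure_closedBall_lt_top.ne),
        volume_closedBall_rpow_mul (by positivity) hw.le,
        ← ENNReal.ofReal_mul (by positivity), ← ENNReal.ofReal_mul (by positivity)]
      apply ENNReal.ofReal_le_ofReal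
      rw [← hv, one_div_mul_cancel hd0.ne', Real.rpow_one]
      calc _ = C₂ * (z / r) ^ (1 + α / (d : ℝ)) := by
            simp only [ha, hC₂]
            rw [Real.mul_rpow hg0.le hw.le, Real.rpow_add hw, Real.rpow_one]
            ring
        _ ≤ _ := by gcongr; exact le_max_right _ _
    · have : I₂ z = ∅ := by
        ext s
        simp only [hI₂, mem_ofPred_eq, mem_empty_iff_false, iff_false]
        exact fun h => hz h.2
      simp [this]

theorem lintegral_Ioi_div_rpow_eq (ν : Measure ℝ) {κ r : ℝ} (hr : 0 < r) :
    ∫⁻ z in Ioi r, ENNReal.ofReal ((z / r) ^ κ) ∂ν =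
      ENNReal.ofReal (r ^ (-κ)) * ∫⁻ z in Ioi r, ENNReal.ofReal (z ^ κ) ∂ν := by
  rw [← lintegral_const_mul _ (by fun_prop)]
  refine setLIntegral_congr_fun measurableSet_Ioi fun z hz => ?_
  have hz0 : 0 < z := hr.trans hz
  change ENNReal.ofReal ((z / r) ^ κ) = ENNReal.ofReal (r ^ (-κ)) * ENNReal.ofReal (z ^ κ)
  rw [← ENNReal.ofReal_mul (by positivity), Real.div_rpow hz0.le hr.le, Real.rpow_neg hr.le,
    div_eq_inv_mul]

theorem lintegral_Ioc_div_rpow_le (ν : Measure ℝ) {β r : ℝ} (hβ : 0 < β) (hr : 1 ≤ r) :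
    ∫⁻ z in Ioc 0 r, ENNReal.ofReal ((z / r) ^ β) ∂ν ≤
      ∫⁻ z in Ioc 0 1, ENNReal.ofReal (z ^ β) ∂ν + ν (Ioi 1) := by
  rw [← Ioc_union_Ioc_eq_Ioc zero_le_one hr, lintegral_union measurableSet_Ioc
    (Set.disjoint_left.2 fun x hx hx' => not_lt.2 hx.2 hx'.1)]
  refine add_le_add ?_ ?_
  · refine setLIntegral_mono' measurableSet_Ioc fun z hz => ENNReal.ofReal_le_ofReal ?_
    have := hz.1.le
    exact Real.rpow_le_rpow (by positivity) (div_le_self this hr) hβ.le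
  · exact lintegral_Ioc_div_rpow_le_measure_Ioi ν hβ zero_le_one (by positivity)

theorem stmt9 (d : ℕ) (hd : 1 ≤ d) (α : ℝ) (hα : α ∈ Set.Ioo (0:ℝ) 2) (t : ℝ) (ht : 0 < t)
    (lam : MeasureTheory.Measure ℝ) [SigmaFinite lam]
    (hlam0 : lam (Set.Iic 0) = 0) (hlam_ne : lam ≠ 0)
    (hmom : ∫⁻ z in Set.Ioi (0:ℝ), ENNReal.ofReal (min 1 (z ^ 2)) ∂lam ≠ ⊤)
    (g : ℝ → ℝ) (hg_cont : ContinuousOn g (Set.Ici 0))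
    (hg_anti : StrictAntiOn g (Set.Ici 0)) (hg_pos : ∀ x : ℝ, 0 ≤ x → 0 < g x)
    (c₀ : ℝ) (hc₀ : 0 < c₀)
    (hg_tail : Filter.Tendsto (fun r : ℝ => r ^ ((d:ℝ) + α) * g r) Filter.atTop (nhds c₀))
    (hsmall : ∫⁻ z in Set.Ioc (0:ℝ) 1, ENNReal.ofReal (z ^ (1 + α / (d:ℝ))) ∂lam ≠ ⊤)
    (hbig : ∫⁻ z in Set.Ioi (1:ℝ), ENNReal.ofReal (z ^ ((d:ℝ) / ((d:ℝ) + α))) ∂lam ≠ ⊤)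
    (l : ℝ → ℝ) (hl : SlowlyVarying l) (hl_pos : ∀ x : ℝ, 0 < x → 0 < l x)
    (hl_int : MeasureTheory.IntegrableOn (fun u => l u / u) (Set.Ioi (1:ℝ))
      MeasureTheory.volume)
    (hlaml : ∃ C : ℝ, 1 ≤ C ∧ ∀ r : ℝ, 1 ≤ r →
      C⁻¹ * (l r / r ^ ((d:ℝ) / ((d:ℝ) + α))) ≤ (lam (Set.Ioi r)).toReal ∧
      (lam (Set.Ioi r)).toReal ≤ C * (l r / r ^ ((d:ℝ) / ((d:ℝ) + α)))) :
    ∃ C : ℝ, 1 ≤ C ∧ ∀ᶠ r : ℝ in Filter.atTop,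
      C⁻¹ * (r ^ (-((d:ℝ) / ((d:ℝ) + α))) * ∫ u in Set.Ioi r, l u / u)
          ≤ (etaBar d α t g lam r).toReal ∧
      (etaBar d α t g lam r).toReal
          ≤ C * (r ^ (-((d:ℝ) / ((d:ℝ) + α))) * ∫ u in Set.Ioi r, l u / u) := by
  have hα0 : 0 < α := hα.1
  have hd0 : (0 : ℝ) < d := by exact_mod_cast hd
  obtain ⟨c, hc, hlow⟩ :=
    exists_le_etaBar hd hα0 ht lam hg_anti.antitoneOn hc₀ hg_tail
  obtain ⟨C₁, hC₁, hup⟩ := exists_etaBar_le hd hα0 ht lam hg_anti.antitoneOn hg_pos hg_tail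
  obtain ⟨C, hC1, hC⟩ := hlaml
  have hC0 : 0 < C := by linarith
  have hκβ : (d : ℝ) / ((d : ℝ) + α) < 1 + α / (d : ℝ) := by
    have h1 : (d : ℝ) / ((d : ℝ) + α) < 1 := (div_lt_one (by positivity)).2 (by linarith)
    have h2 : 0 < α / (d : ℝ) := by positivity
    linarith
  have hκ : 0 < (d : ℝ) / ((d : ℝ) + α) := by positivity
  generalize (d : ℝ) / ((d : ℝ) + α) = κ at *
  generalize 1 + α / (d : ℝ) = β at *
  have hβ : 0 < β := by linarith
  have hfin1 : lam (Ioi 1) ≠ ⊤ := by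
    refine ne_top_of_le_ne_top hbig ?_
    calc lam (Ioi 1) = ∫⁻ z in Ioi (1:ℝ), 1 ∂lam := by simp
      _ ≤ _ := by
        refine setLIntegral_mono' measurableSet_Ioi fun z hz => ?_
        rw [ENNReal.one_le_ofReal]
        exact Real.one_le_rpow (mem_Ioi.1 hz).le hκ.le
  have hfin : ∀ r, 1 ≤ r → lam (Ioi r) ≠ ⊤ := fun r hr =>
    ne_top_of_le_ne_top hfin1 (measure_mono (Ioi_subset_Ioi hr))
  set F : ℝ → ℝ := fun r => (lam (Ioi r)).toReal with hF
  have hFanti : AntitoneOn F (Ici 1) := fun x hx y _ hxy =>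
    ENNReal.toReal_mono (hfin x hx) (measure_mono (Ioi_subset_Ioi hxy))
  set L : ℝ → ℝ := fun r => ∫ u in Ioi r, l u / u with hL
  have hLtail : ∀ x, 1 ≤ x → x ^ κ * F (2 * x) ≤ 2 * C * L x := fun x hx =>
    rpow_mul_le_tail hκ.le hC0 hx hl_pos hl_int (fun r hr => (hC r hr).2)
      (fun r => ENNReal.toReal_nonneg) hFanti
  have hLpos : ∀ x, 1 ≤ x → 0 < L x := by
    intro x hx
    have hx0 : 0 < x := by linarith
    have h1 : 0 < F (2 * x) := by
      refine lt_of_lt_of_le ?_ (hC (2 * x) (by linarith)).1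
      have := hl_pos (2 * x) (by linarith)
      positivity
    have h2 : 0 < 2 * C * L x := lt_of_lt_of_le (by positivity) (hLtail x hx)
    exact pos_of_mul_pos_right h2 (by positivity)
  have hLanti : ∀ x y, 1 ≤ x → x ≤ y → L y ≤ L x := by
    intro x y hx hxy
    refine setIntegral_mono_set (hl_int.mono_set (Ioi_subset_Ioi hx)) ?_
      (Ioi_subset_Ioi hxy).eventuallyLE
    filter_upwards [ae_restrict_mem measurableSet_Ioi] with u hu
    have hu0 : 0 < u := by have := mem_Ioi.1 hu; linarith
    exact (div_pos (hl_pos u hu0) hu0).le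
  have hLint : ∀ (a : ℝ) r, 0 ≤ a → 1 ≤ r →
      ENNReal.ofReal (a * L r) = ∫⁻ u in Ioi r, ENNReal.ofReal (a * (l u / u)) := by
    intro a r ha hr
    rw [hL, ← integral_const_mul]
    refine ofReal_integral_eq_lintegral_ofReal
      ((hl_int.mono_set (Ioi_subset_Ioi hr)).const_mul a) ?_
    filter_upwards [ae_restrict_mem measurableSet_Ioi] with u hu
    have hu0 : 0 < u := by have := mem_Ioi.1 hu; linarith
    have := hl_pos u hu0
    simp only [Pi.zero_apply]
    positivity
  have hprod : ∀ u, 1 ≤ u → lam (Ioi u) * ENNReal.ofReal (u ^ (κ - 1)) =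
      ENNReal.ofReal (F u * u ^ (κ - 1)) := by
    intro u hu
    rw [ENNReal.ofReal_mul ENNReal.toReal_nonneg, ENNReal.ofReal_toReal (hfin u hu)]
  have hcancel : ∀ a u, 0 < u → a * (l u / u ^ κ) * u ^ (κ - 1) = a * (l u / u) := by
    intro a u hu
    rw [Real.rpow_sub_one hu.ne']
    field_simp
  have hT_le : ∀ r, 1 ≤ r → ∫⁻ u in Ioi r, lam (Ioi u) * ENNReal.ofReal (u ^ (κ - 1)) ≤
      ENNReal.ofReal (C * L r) := by
    intro r hr
    rw [hLint C r hC0.le hr]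
    refine setLIntegral_mono' measurableSet_Ioi fun u hu => ?_
    have hu1 : 1 ≤ u := hr.trans (mem_Ioi.1 hu).le
    have hu0 : 0 < u := by linarith
    rw [hprod u hu1, ← hcancel C u hu0]
    apply ENNReal.ofReal_le_ofReal
    gcongr
    exact (hC u hu1).2
  have hle_T : ∀ r, 1 ≤ r → ENNReal.ofReal (C⁻¹ * L r) ≤
      ∫⁻ u in Ioi r, lam (Ioi u) * ENNReal.ofReal (u ^ (κ - 1)) := by
    intro r hr
    rw [hLint C⁻¹ r (by positivity) hr]
    refine setLIntegral_mono' measurableSet_Ioi fun u hu => ?_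
    have hu1 : 1 ≤ u := hr.trans (mem_Ioi.1 hu).le
    have hu0 : 0 < u := by linarith
    rw [hprod u hu1, ← hcancel C⁻¹ u hu0]
    apply ENNReal.ofReal_le_ofReal
    gcongr
    exact (hC u hu1).1
  set K : ℝ := 2 ^ ((β - κ) / 2) with hKdef
  have hK1 : 1 < K := Real.one_lt_rpow one_lt_two (by linarith)
  have hK0 : 0 < K := by linarith
  obtain ⟨R₀, hR₀⟩ := eventually_atTop.1 (hl.tail_le_mul_tail_two_mul hl_pos hl_int hK1)
  set M : ℝ → ℝ := fun r => r ^ (-κ) * L r with hM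
  have hMpos : ∀ r, 1 ≤ r → 0 < M r := fun r hr =>
    mul_pos (Real.rpow_pos_of_pos (by linarith) _) (hLpos r hr)
  set R := 2 * max R₀ 1 with hR
  have hR1 : 1 ≤ R := by have := le_max_right R₀ 1; linarith
  set A := 2 * C * K * 2 ^ κ with hA
  have hν : ∀ r, R ≤ r → lam (Ioi r) ≤ ENNReal.ofReal (A * M r) := by
    intro r hr
    obtain ⟨x, rfl⟩ : ∃ x, r = 2 * x := ⟨r / 2, by ring⟩
    have hx : max R₀ 1 ≤ x := by linarith
    have hx1 : 1 ≤ x := (le_max_right _ _).trans hx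
    have hx0 : 0 < x := by linarith
    rw [ENNReal.le_ofReal_iff_toReal_le (hfin _ (by linarith))
      (mul_nonneg (by positivity) (hMpos _ (by linarith)).le)]
    have h1 := hLtail x hx1
    have h2 : L x ≤ K * L (2 * x) := hR₀ x ((le_max_left _ _).trans hx)
    have h3 : A * M (2 * x) = 2 * C * (K * L (2 * x)) / x ^ κ := by
      rw [hA, hM]
      simp only
      rw [Real.rpow_neg (by positivity), Real.mul_rpow zero_le_two hx0.le]
      field_simp
    rw [h3, le_div_iff₀ (by positivity)]
    change F (2 * x) * x ^ κ ≤ _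
    calc F (2 * x) * x ^ κ ≤ 2 * C * L x := by linarith
      _ ≤ _ := by gcongr
  have hMdouble : ∀ r, R ≤ r → M r ≤ 2 ^ κ * K * M (2 * r) := by
    intro r hr
    have hr0 : 0 < r := by linarith
    have h2 : L r ≤ K * L (2 * r) := hR₀ r (by
      have := le_max_left R₀ 1
      have := le_max_right R₀ 1
      linarith)
    rw [hM]
    simp only
    rw [Real.mul_rpow zero_le_two hr0.le, Real.rpow_neg zero_le_two]
    calc r ^ (-κ) * L r ≤ r ^ (-κ) * (K * L (2 * r)) := by gcongr
      _ = _ := by field_simp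
  have hmβ : 2 ^ κ * K * (2 : ℝ) ^ (-β) < 1 := by
    rw [hKdef, ← Real.rpow_add two_pos, ← Real.rpow_add two_pos]
    exact Real.rpow_lt_one_of_one_lt_of_neg one_lt_two (by linarith)
  set D := ∫⁻ z in Ioc 0 1, ENNReal.ofReal (z ^ β) ∂lam + lam (Ioi 1) with hD
  have hDtop : D ≠ ⊤ := ENNReal.add_ne_top.2 ⟨hsmall, hfin1⟩
  have hMR := hMpos (2 * R) (by linarith)
  obtain ⟨K', hK'0, hK'⟩ := exists_lintegral_Ioc_div_rpow_le lam (M := M) (A := A) (R := R)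
    (B := D.toReal / M (2 * R)) hβ (by linarith) (by positivity) hmβ (by positivity)
    (fun r hr => (hMpos r (hR1.trans hr)).le) hMdouble hν (by
      intro r hr
      have hr1 : 1 ≤ r := hR1.trans hr.1
      refine (lintegral_Ioc_div_rpow_le lam hβ hr1).trans ?_
      rw [← hD, ENNReal.le_ofReal_iff_toReal_le hDtop
        (mul_nonneg (by positivity) (hMpos _ hr1).le), div_mul_eq_mul_div, le_div_iff₀ hMR]
      gcongr
      have h1 := hLanti r (2 * R) hr1 hr.2
      have h2 : (2 * R) ^ (-κ) ≤ r ^ (-κ) :=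
        Real.rpow_le_rpow_of_nonpos (by linarith) hr.2 (by linarith)
      exact mul_le_mul h2 h1 (hLpos _ (by linarith)).le (by positivity))
  refine ⟨max 1 (max (C₁ * (A + κ * C + K')) (c * κ * C⁻¹)⁻¹), le_max_left _ _, ?_⟩
  set C' := max 1 (max (C₁ * (A + κ * C + K')) (c * κ * C⁻¹)⁻¹) with hC'
  have hC'1 : C₁ * (A + κ * C + K') ≤ C' := (le_max_left _ _).trans (le_max_right _ _)
  have hC'2 : (c * κ * C⁻¹)⁻¹ ≤ C' := (le_max_right _ _).trans (le_max_right _ _)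
  filter_upwards [eventually_ge_atTop R] with r hr
  have hr1 : 1 ≤ r := hR1.trans hr
  have hr0 : 0 < r := by linarith
  have hMr := hMpos r hr1
  have hLr := hLpos r hr1
  have hupper : etaBar d α t g lam r ≤ ENNReal.ofReal (C₁ * (A + κ * C + K') * M r) := by
    refine (hup r hr0).trans ?_
    rw [lintegral_Ioi_div_rpow_eq lam hr0, lintegral_Ioi_rpow_eq lam hκ hr0]
    calc _ ≤ ENNReal.ofReal C₁ * (ENNReal.ofReal (r ^ (-κ)) * (ENNReal.ofReal (r ^ κ) *
            ENNReal.ofReal (A * M r) + ENNReal.ofReal κ * ENNReal.ofReal (C * L r)) +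
            ENNReal.ofReal (K' * M r)) := by
          gcongr
          · exact hν r hr
          · exact hT_le r hr1
          · exact hK' r hr
      _ = _ := by
          have hA0 : 0 < A := by positivity
          rw [← ENNReal.ofReal_mul (by positivity), ← ENNReal.ofReal_mul (by positivity),
            ← ENNReal.ofReal_add (by positivity) (by positivity),
            ← ENNReal.ofReal_mul (by positivity),
            ← ENNReal.ofReal_add (by positivity) (by positivity),
            ← ENNReal.ofReal_mul (by positivity)]
          congr 1
          rw [hM]
          simp only
          rw [Real.rpow_neg hr0.le]
          field_simp
  have hlower : ENNReal.ofReal (c * κ * C⁻¹ * M r) ≤ etaBar d α t g lam r := by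
    refine le_trans ?_ (hlow r hr0)
    rw [lintegral_Ioi_div_rpow_eq lam hr0, lintegral_Ioi_rpow_eq lam hκ hr0]
    calc ENNReal.ofReal (c * κ * C⁻¹ * M r) = ENNReal.ofReal c * (ENNReal.ofReal (r ^ (-κ)) *
          (ENNReal.ofReal κ * ENNReal.ofReal (C⁻¹ * L r))) := by
          rw [← ENNReal.ofReal_mul (by positivity), ← ENNReal.ofReal_mul (by positivity),
            ← ENNReal.ofReal_mul (by positivity)]
          congr 1
          rw [hM]
          ring
      _ ≤ _ := by
          gcongr
          refine le_trans ?_ le_add_self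
          gcongr
          exact hle_T r hr1
  have htop : etaBar d α t g lam r ≠ ⊤ := ne_top_of_le_ne_top ENNReal.ofReal_ne_top hupper
  change C'⁻¹ * M r ≤ _ ∧ _ ≤ C' * M r
  constructor
  · refine le_trans ?_ ((ENNReal.ofReal_le_iff_le_toReal htop).1 hlower)
    gcongr
    exact inv_le_of_inv_le₀ (by positivity) hC'2
  · refine (ENNReal.toReal_le_of_le_ofReal ?_ hupper).trans ?_
    · have hA0 : 0 < A := by positivity
      positivity
    · gcongr
end
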